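/- Suppose ↪_{β𝓡} is confluent and 𝓡 is arity-preserving, and let M be an object or a type family. Then: (1) if N is an object, M{N/x} is an object or type family and |M{N/x}| = |M|{|N|/x}; (2) if M ↪_β N (one β-step), then N is an object or type family and |M| reduces to |N| in one or more β-steps in the simply-typed λ-calculus. -/

import Mathlib

namespace DKPaper

inductive Tm (C : Type) : Type
  | var : Nat → Tm C
  | const : C → List (Tm C) → Tm C
  | type : Tm C
  | kind : Tm C
  | app : Tm C → Tm C → Tm C
  | lam : Tm C → Tm C → Tm C
  | pi : Tm C → Tm C → Tm C

namespace Tm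
variable {C : Type}

def liftRen (ρ : Nat → Nat) : Nat → Nat
  | 0 => 0
  | n + 1 => ρ n + 1

def ren (ρ : Nat → Nat) : Tm C → Tm C
  | var n => var (ρ n)
  | const c Ms => const c (Ms.attach.map fun x => ren ρ x.1)
  | type => type
  | kind => kind
  | app M N => app (ren ρ M) (ren ρ N)
  | lam A M => lam (ren ρ A) (ren (liftRen ρ) M)
  | pi A B => pi (ren ρ A) (ren (liftRen ρ) B)
termination_by t => sizeOf t
decreasing_by
  all_goals simp_wf
  all_goals try omega
  all_goals (have h := List.sizeOf_lt_of_mem x.2; omega)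

def liftSub (σ : Nat → Tm C) : Nat → Tm C
  | 0 => var 0
  | n + 1 => ren Nat.succ (σ n)

def sub (σ : Nat → Tm C) : Tm C → Tm C
  | var n => σ n
  | const c Ms => const c (Ms.attach.map fun x => sub σ x.1)
  | type => type
  | kind => kind
  | app M N => app (sub σ M) (sub σ N)
  | lam A M => lam (sub σ A) (sub (liftSub σ) M)
  | pi A B => pi (sub σ A) (sub (liftSub σ) B)
termination_by t => sizeOf t
decreasing_by
  all_goals simp_wf
  all_goals try omega
  all_goals (have h := List.sizeOf_lt_of_mem x.2; omega)

/-- Substitution of `N` for the variable of de Bruijn index `k` (the usual `M{N/x}`). -/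
def substAt (k : Nat) (N : Tm C) : Tm C → Tm C :=
  sub fun n => if n < k then var n else if n = k then ren (· + k) N else var (n - 1)

end Tm

/-! ## Signatures, rewrite rules, rewriting -/

/-- An entry `c[Δ] : A` of a signature: head constant, telescope (in declaration
order, each entry a type under the previous ones), and the type. -/
abbrev Sig (C : Type) := Set (C × List (Tm C) × Tm C)

/-- A rewrite rule `c[l⃗] ↪ r`: head constant, list of left-hand side argument
patterns (free de Bruijn variables are the pattern variables), right-hand side. -/
abbrev Rules (C : Type) := Set (C × List (Tm C) × Tm C)

variable {C : Type}

/-- Closure of a root relation under all term-forming contexts. -/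
inductive Cong (r : Tm C → Tm C → Prop) : Tm C → Tm C → Prop
  | base {M N} : r M N → Cong r M N
  | appL {M M' N} : Cong r M M' → Cong r (.app M N) (.app M' N)
  | appR {M N N'} : Cong r N N' → Cong r (.app M N) (.app M N')
  | lamA {A A' M} : Cong r A A' → Cong r (.lam A M) (.lam A' M)
  | lamM {A M M'} : Cong r M M' → Cong r (.lam A M) (.lam A M')
  | piA {A A' B} : Cong r A A' → Cong r (.pi A B) (.pi A' B)
  | piB {A B B'} : Cong r B B' → Cong r (.pi A B) (.pi A B')
  | constArg {c l₁ M M' l₂} : Cong r M M' →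
      Cong r (.const c (l₁ ++ M :: l₂)) (.const c (l₁ ++ M' :: l₂))

/-- Root β-reduction. -/
def BetaRoot : Tm C → Tm C → Prop := fun M N =>
  ∃ A P Q, M = .app (.lam A P) Q ∧ N = Tm.substAt 0 Q P

/-- Root reduction by a rule of `R`: a substitution instance of some rule. -/
def RuleRoot (R : Rules C) : Tm C → Tm C → Prop := fun M N =>
  ∃ rl ∈ R, ∃ σ : Nat → Tm C,
    M = Tm.sub σ (.const rl.1 rl.2.1) ∧ N = Tm.sub σ rl.2.2

/-- One-step β-reduction `↪_β`. -/
def Beta : Tm C → Tm C → Prop := Cong BetaRoot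

/-- One-step reduction by the rules of `R` only (no β). -/
def RStep (R : Rules C) : Tm C → Tm C → Prop := Cong (RuleRoot R)

/-- One-step reduction `↪_{β𝓡}`. -/
def Step (R : Rules C) : Tm C → Tm C → Prop :=
  Cong (fun M N => BetaRoot M N ∨ RuleRoot R M N)

/-- The conversion `≡_{β𝓡}` generated by `↪_{β𝓡}`. -/
def Conv (R : Rules C) : Tm C → Tm C → Prop := Relation.EqvGen (Step R)

/-- Confluence of an abstract reduction relation. -/
def Confluent {α : Type _} (r : α → α → Prop) : Prop :=
  ∀ a b c, Relation.ReflTransGen r a b → Relation.ReflTransGen r a c →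
    ∃ d, Relation.ReflTransGen r b d ∧ Relation.ReflTransGen r c d

/-- `M` is in β-normal form. -/
def BetaNormal (M : Tm C) : Prop := ∀ N, ¬ Beta M N

/-- Strong normalization of a relation at a point: no infinite `r`-sequence starts at `a`. -/
def SN {α : Type _} (r : α → α → Prop) (a : α) : Prop := Acc (fun x y => r y x) a


/-! ## Dedukti typing -/

/-- `IsDKSort s` means `s` is `TYPE` or `KIND`. -/
def IsDKSort (s : Tm C) : Prop := s = Tm.type ∨ s = Tm.kind

/-- `A{M⃗}`: simultaneous instantiation of the telescope variables by the arguments. -/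
def instArgs (Ms : List (Tm C)) (A : Tm C) : Tm C :=
  Tm.sub (fun n => Ms.reverse.getD n (Tm.var (n - Ms.length))) A

/-- Instantiate the first variable of the (remaining) telescope `Δ` with `M`. -/
def instTele (M : Tm C) (Δ : List (Tm C)) : List (Tm C) :=
  Δ.mapIdx fun i B => Tm.substAt i M B

mutual
/-- Well-formed contexts `Σ;Γ well-formed` (de Bruijn: last declaration first). -/
inductive Wf (S : Sig C) (R : Rules C) : List (Tm C) → Prop
  | empty : Wf S R []
  | decl {Γ A} : Typed S R Γ A Tm.type → Wf S R (A :: Γ)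

/-- The Dedukti typing judgment `Σ;Γ ⊢ M : A`. -/
inductive Typed (S : Sig C) (R : Rules C) : List (Tm C) → Tm C → Tm C → Prop
  | sort {Γ} : Wf S R Γ → Typed S R Γ Tm.type Tm.kind
  | var {Γ n A} : Wf S R Γ → Γ[n]? = some A →
      Typed S R Γ (Tm.var n) (Tm.ren (· + (n + 1)) A)
  | cons {Γ c Δ A s Ms} : (c, Δ, A) ∈ S → Typed S R Δ.reverse A s → IsDKSort s →
      TypedArgs S R Γ Ms Δ → Typed S R Γ (Tm.const c Ms) (instArgs Ms A)
  | conv {Γ M A B s} : Typed S R Γ M A → Typed S R Γ B s → IsDKSort s →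
      Conv R A B → Typed S R Γ M B
  | prod {Γ A B s} : Typed S R Γ A Tm.type → Typed S R (A :: Γ) B s → IsDKSort s →
      Typed S R Γ (Tm.pi A B) s
  | abs {Γ A B s M} : Typed S R Γ A Tm.type → Typed S R (A :: Γ) B s → IsDKSort s →
      Typed S R (A :: Γ) M B → Typed S R Γ (Tm.lam A M) (Tm.pi A B)
  | app {Γ M N A B} : Typed S R Γ M (Tm.pi A B) → Typed S R Γ N A →
      Typed S R Γ (Tm.app M N) (Tm.substAt 0 N B)

/-- `Σ;Γ ⊢ M⃗ : Δ`: the arguments fit the telescope. -/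
inductive TypedArgs (S : Sig C) (R : Rules C) : List (Tm C) → List (Tm C) → List (Tm C) → Prop
  | nil {Γ} : TypedArgs S R Γ [] []
  | cons {Γ M Ms A Δ} : Typed S R Γ M A → TypedArgs S R Γ Ms (instTele M Δ) →
      TypedArgs S R Γ (M :: Ms) (A :: Δ)
end

/-! ## Type-level and object-level constants, syntactic classes -/

/-- Types of the form `Πx⃗:B⃗.TYPE`. -/
inductive IsKindShape : Tm C → Prop
  | type : IsKindShape Tm.type
  | pi {A K} : IsKindShape K → IsKindShape (Tm.pi A K)

/-- `c` is a type-level constant of the signature `S`. -/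
def TypeLevel (S : Sig C) (c : C) : Prop := ∃ Δ A, (c, Δ, A) ∈ S ∧ IsKindShape A

/-- `c` is an object-level constant of the signature `S`: it is declared, and not type-level. -/
def ObjLevel (S : Sig C) (c : C) : Prop := (∃ Δ A, (c, Δ, A) ∈ S) ∧ ¬ TypeLevel S c

mutual
/-- Kinds: `K ::= TYPE | Πx:T.K`. -/
inductive IsKind (S : Sig C) : Tm C → Prop
  | type : IsKind S Tm.type
  | pi {T K} : IsTypeFam S T → IsKind S K → IsKind S (Tm.pi T K)

/-- Type families: `T ::= α[O⃗] | T O | λx:T.T | Πx:T.T` with `α` type-level. -/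
inductive IsTypeFam (S : Sig C) : Tm C → Prop
  | const {c Os} : TypeLevel S c → (∀ O ∈ Os, IsObj S O) → IsTypeFam S (Tm.const c Os)
  | app {T O} : IsTypeFam S T → IsObj S O → IsTypeFam S (Tm.app T O)
  | lam {T₁ T₂} : IsTypeFam S T₁ → IsTypeFam S T₂ → IsTypeFam S (Tm.lam T₁ T₂)
  | pi {T₁ T₂} : IsTypeFam S T₁ → IsTypeFam S T₂ → IsTypeFam S (Tm.pi T₁ T₂)

/-- Objects: `O ::= x | a[O⃗] | O O | λx:T.O` with `a` object-level. -/
inductive IsObj (S : Sig C) : Tm C → Prop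
  | var {n} : IsObj S (Tm.var n)
  | const {c Os} : ObjLevel S c → (∀ O ∈ Os, IsObj S O) → IsObj S (Tm.const c Os)
  | app {O₁ O₂} : IsObj S O₁ → IsObj S O₂ → IsObj S (Tm.app O₁ O₂)
  | lam {T O} : IsTypeFam S T → IsObj S O → IsObj S (Tm.lam T O)
end

mutual
/-- Pre-kinds: `L ::= TYPE | Πx:R.L`. -/
inductive PreKind (S : Sig C) : Tm C → Prop
  | type : PreKind S Tm.type
  | pi {R L} : PreTypeFam S R → PreKind S L → PreKind S (Tm.pi R L)

/-- Pre-type families: `R ::= α[M⃗] | R N | λx:A.R | Πx:R.R` with `α` type-level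
and `M⃗`, `N`, `A` arbitrary. -/
inductive PreTypeFam (S : Sig C) : Tm C → Prop
  | const {c Ms} : TypeLevel S c → PreTypeFam S (Tm.const c Ms)
  | app {R N} : PreTypeFam S R → PreTypeFam S (Tm.app R N)
  | lam {A R} : PreTypeFam S R → PreTypeFam S (Tm.lam A R)
  | pi {R₁ R₂} : PreTypeFam S R₁ → PreTypeFam S R₂ → PreTypeFam S (Tm.pi R₁ R₂)
end

/-- A rewrite rule is type-level when its head constant is type-level. -/
def TypeLevelRule (S : Sig C) (rl : C × List (Tm C) × Tm C) : Prop := TypeLevel S rl.1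

/-- The grammar `R ::= α[M⃗] | R N | λx:A.R` used to define arity preservation. -/
inductive APShape (S : Sig C) : Tm C → Prop
  | const {c Ms} : TypeLevel S c → APShape S (Tm.const c Ms)
  | app {R N} : APShape S R → APShape S (Tm.app R N)
  | lam {A R} : APShape S R → APShape S (Tm.lam A R)

/-- `𝓡` is arity preserving (w.r.t. `Σ`). -/
def ArityPreserving (S : Sig C) (R : Rules C) : Prop :=
  ∀ rl ∈ R, TypeLevelRule S rl → APShape S rl.2.2

/-- `𝓡` is well-formed (w.r.t. `Σ`): right-hand sides of type-level rules are in
the grammar `R ::= α[M⃗] | R N | λx:B.R | Πx:R.R`. -/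
def RulesWellFormed (S : Sig C) (R : Rules C) : Prop :=
  ∀ rl ∈ R, TypeLevelRule S rl → PreTypeFam S rl.2.2

/-! ## Simple types and the erasure maps -/

/-- Simple types `σ ::= * | σ → σ`. -/
inductive STy : Type
  | star : STy
  | arr : STy → STy → STy
deriving DecidableEq

open Classical in
/-- The partial type erasure `⌈·⌉` from Dedukti terms to simple types. -/
noncomputable def tyErase (S : Sig C) : Tm C → Option STy
  | Tm.type => some STy.star
  | Tm.const c _ => if TypeLevel S c then some STy.star else none
  | Tm.pi A B => do return STy.arr (← tyErase S A) (← tyErase S B)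
  | Tm.app A _ => tyErase S A
  | Tm.lam _ B => tyErase S B
  | Tm.var _ => none
  | Tm.kind => none

/-- Untyped λ-terms with constants in `K` (the target of the term erasure). -/
inductive LTm (K : Type) : Type
  | var : Nat → LTm K
  | const : K → LTm K
  | app : LTm K → LTm K → LTm K
  | lam : LTm K → LTm K

namespace LTm
variable {K : Type}

def liftRen' (ρ : Nat → Nat) : Nat → Nat
  | 0 => 0
  | n + 1 => ρ n + 1

def ren (ρ : Nat → Nat) : LTm K → LTm K
  | var n => var (ρ n)
  | const k => const k
  | app M N => app (ren ρ M) (ren ρ N)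
  | lam M => lam (ren (liftRen' ρ) M)

/-- Shift free variables `≥ d` up by one. -/
def shiftAbove (d : Nat) : LTm K → LTm K :=
  ren fun n => if n < d then n else n + 1

def liftSub (σ : Nat → LTm K) : Nat → LTm K
  | 0 => var 0
  | n + 1 => ren Nat.succ (σ n)

def sub (σ : Nat → LTm K) : LTm K → LTm K
  | var n => σ n
  | const k => const k
  | app M N => app (sub σ M) (sub σ N)
  | lam M => lam (sub (liftSub σ) M)

/-- Substitution `M{N/x}` for the variable of index `k`. -/
def substAt (k : Nat) (N : LTm K) : LTm K → LTm K :=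
  sub fun n => if n < k then var n else if n = k then ren (· + k) N else var (n - 1)

end LTm

/-- β-reduction for the (simply-typed) λ-calculus. -/
inductive LBeta {K : Type} : LTm K → LTm K → Prop
  | red {M N} : LBeta (LTm.app (LTm.lam M) N) (LTm.substAt 0 N M)
  | appL {M M' N} : LBeta M M' → LBeta (LTm.app M N) (LTm.app M' N)
  | appR {M N N'} : LBeta N N' → LBeta (LTm.app M N) (LTm.app M N')
  | lam {M M'} : LBeta M M' → LBeta (LTm.lam M) (LTm.lam M')

/-- The partial term erasure `|·|` from Dedukti terms into the λ-calculus with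
constants `C ⊕ STy` (`Sum.inr σ` being the constant `π_σ`). -/
noncomputable def erase (S : Sig C) : Tm C → Option (LTm (C ⊕ STy))
  | Tm.var n => some (LTm.var n)
  | Tm.const c Ms => do
      let ts ← Ms.attach.mapM fun x => erase S x.1
      return ts.foldl LTm.app (LTm.const (Sum.inl c))
  | Tm.app M N => do return LTm.app (← erase S M) (← erase S N)
  | Tm.lam A M => do
      return LTm.app (LTm.lam (LTm.lam (LTm.shiftAbove 1 (← erase S M)))) (← erase S A)
  | Tm.pi A B => do
      return LTm.app (LTm.app (LTm.const (Sum.inr (← tyErase S A))) (← erase S A))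
        (LTm.lam (← erase S B))
  | Tm.type => none
  | Tm.kind => none
termination_by t => sizeOf t
decreasing_by
  all_goals simp_wf
  all_goals try omega
  all_goals (have h := List.sizeOf_lt_of_mem x.2; omega)

/-- The type `* → (σ → *) → *` of the constant `π_σ`. -/
def piConstTy (σ : STy) : STy := STy.arr STy.star (STy.arr (STy.arr σ STy.star) STy.star)

/-- `⌈A₁⌉ → ... → ⌈Aₙ⌉ → ⌈A⌉`, as a relation (defined when all erasures are). -/
inductive EraseTele (S : Sig C) : List (Tm C) → Tm C → STy → Prop
  | nil {A σ} : tyErase S A = some σ → EraseTele S [] A σ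
  | cons {B Δ A τ σ} : tyErase S B = some τ → EraseTele S Δ A σ →
      EraseTele S (B :: Δ) A (STy.arr τ σ)

/-- The simply-typed constant context `Γ_π, ⌈Σ'⌉`: it declares `π_σ : * → (σ → *) → *`
for every simple type `σ`, and `c : ⌈A₁⌉ → ... → ⌈Aₙ⌉ → ⌈A⌉` for every
declaration `c[x₁:A₁,...,xₙ:Aₙ] : A` of `Σ'` (erasures being taken w.r.t. `S`). -/
inductive ConstTy (S : Sig C) (S' : Sig C) : C ⊕ STy → STy → Prop
  | piConst (σ : STy) : ConstTy S S' (Sum.inr σ) (piConstTy σ)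
  | const {c Δ A σ} : (c, Δ, A) ∈ S' → EraseTele S Δ A σ → ConstTy S S' (Sum.inl c) σ

/-- Typing in the simply-typed λ-calculus, with constants typed by `cty`. -/
inductive STTyped {K : Type} (cty : K → STy → Prop) : List STy → LTm K → STy → Prop
  | var {Γ n σ} : Γ[n]? = some σ → STTyped cty Γ (LTm.var n) σ
  | const {Γ k σ} : cty k σ → STTyped cty Γ (LTm.const k) σ
  | app {Γ M N σ τ} : STTyped cty Γ M (STy.arr σ τ) → STTyped cty Γ N σ →
      STTyped cty Γ (LTm.app M N) τ
  | lam {Γ M σ τ} : STTyped cty (σ :: Γ) M τ → STTyped cty Γ (LTm.lam M) (STy.arr σ τ)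

/-! ## Explicitly-typed Pure Type Systems (EPTS) -/

/-- EPTS terms (de Bruijn): `x | s | Π_{s₁,s₂}(A,[x]B) | λ_{s₁,s₂}(A,[x]B,[x]M) |
@_{s₁,s₂}(A,[x]B,M,N)`. -/
inductive ETm (S : Type) : Type
  | var : Nat → ETm S
  | sort : S → ETm S
  | pi : S → S → ETm S → ETm S → ETm S
  | lam : S → S → ETm S → ETm S → ETm S → ETm S
  | app : S → S → ETm S → ETm S → ETm S → ETm S → ETm S

namespace ETm
variable {S : Type}

def ren (ρ : Nat → Nat) : ETm S → ETm S
  | var n => var (ρ n)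
  | sort s => sort s
  | pi s₁ s₂ A B => pi s₁ s₂ (ren ρ A) (ren (Tm.liftRen ρ) B)
  | lam s₁ s₂ A B M => lam s₁ s₂ (ren ρ A) (ren (Tm.liftRen ρ) B) (ren (Tm.liftRen ρ) M)
  | app s₁ s₂ A B M N => app s₁ s₂ (ren ρ A) (ren (Tm.liftRen ρ) B) (ren ρ M) (ren ρ N)

def liftSub (σ : Nat → ETm S) : Nat → ETm S
  | 0 => var 0
  | n + 1 => ren Nat.succ (σ n)

def sub (σ : Nat → ETm S) : ETm S → ETm S
  | var n => σ n
  | sort s => sort s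
  | pi s₁ s₂ A B => pi s₁ s₂ (sub σ A) (sub (liftSub σ) B)
  | lam s₁ s₂ A B M => lam s₁ s₂ (sub σ A) (sub (liftSub σ) B) (sub (liftSub σ) M)
  | app s₁ s₂ A B M N => app s₁ s₂ (sub σ A) (sub (liftSub σ) B) (sub σ M) (sub σ N)

/-- Substitution `M{N/x}` for the variable of de Bruijn index `k`. -/
def substAt (k : Nat) (N : ETm S) : ETm S → ETm S :=
  sub fun n => if n < k then var n else if n = k then ren (· + k) N else var (n - 1)

end ETm

variable {S : Type}

/-- Closure of a root relation under all EPTS term-forming contexts. -/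
inductive ECong (r : ETm S → ETm S → Prop) : ETm S → ETm S → Prop
  | base {M N} : r M N → ECong r M N
  | piA {s₁ s₂ A A' B} : ECong r A A' → ECong r (.pi s₁ s₂ A B) (.pi s₁ s₂ A' B)
  | piB {s₁ s₂ A B B'} : ECong r B B' → ECong r (.pi s₁ s₂ A B) (.pi s₁ s₂ A B')
  | lamA {s₁ s₂ A A' B M} : ECong r A A' → ECong r (.lam s₁ s₂ A B M) (.lam s₁ s₂ A' B M)
  | lamB {s₁ s₂ A B B' M} : ECong r B B' → ECong r (.lam s₁ s₂ A B M) (.lam s₁ s₂ A B' M)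
  | lamM {s₁ s₂ A B M M'} : ECong r M M' → ECong r (.lam s₁ s₂ A B M) (.lam s₁ s₂ A B M')
  | appA {s₁ s₂ A A' B M N} : ECong r A A' → ECong r (.app s₁ s₂ A B M N) (.app s₁ s₂ A' B M N)
  | appB {s₁ s₂ A B B' M N} : ECong r B B' → ECong r (.app s₁ s₂ A B M N) (.app s₁ s₂ A B' M N)
  | appM {s₁ s₂ A B M M' N} : ECong r M M' → ECong r (.app s₁ s₂ A B M N) (.app s₁ s₂ A B M' N)
  | appN {s₁ s₂ A B M N N'} : ECong r N N' → ECong r (.app s₁ s₂ A B M N) (.app s₁ s₂ A B M N')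

/-- Root β-reduction of the EPTS (linearized rule, one instance per `(s₁,s₂,s₃) ∈ ℛ`):
`@_{s₁,s₂}(A,[x]B, λ_{s₁,s₂}(A',[x]B',[x]M), N) ↪ M{N/x}`. -/
def EBetaRoot (Rrel : S → S → S → Prop) : ETm S → ETm S → Prop := fun M N =>
  ∃ s₁ s₂ s₃ A B A' B' P Q, Rrel s₁ s₂ s₃ ∧
    M = ETm.app s₁ s₂ A B (ETm.lam s₁ s₂ A' B' P) Q ∧ N = ETm.substAt 0 Q P

/-- One-step EPTS reduction. -/
def EStep (Rrel : S → S → S → Prop) : ETm S → ETm S → Prop := ECong (EBetaRoot Rrel)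

/-- EPTS conversion `≡`. -/
def EConv (Rrel : S → S → S → Prop) : ETm S → ETm S → Prop := Relation.EqvGen (EStep Rrel)

mutual
/-- Well-formed EPTS contexts. -/
inductive EWf (Ar : S → S → Prop) (Rr : S → S → S → Prop) : List (ETm S) → Prop
  | empty : EWf Ar Rr []
  | decl {Γ A s} : ETyped Ar Rr Γ A (ETm.sort s) → EWf Ar Rr (A :: Γ)

/-- The EPTS typing judgment `Γ ⊢ M : A`. -/
inductive ETyped (Ar : S → S → Prop) (Rr : S → S → S → Prop) : List (ETm S) → ETm S → ETm S → Prop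
  | sort {Γ s₁ s₂} : EWf Ar Rr Γ → Ar s₁ s₂ → ETyped Ar Rr Γ (ETm.sort s₁) (ETm.sort s₂)
  | var {Γ n A} : EWf Ar Rr Γ → Γ[n]? = some A →
      ETyped Ar Rr Γ (ETm.var n) (ETm.ren (· + (n + 1)) A)
  | conv {Γ M A B s} : ETyped Ar Rr Γ M A → ETyped Ar Rr Γ B (ETm.sort s) →
      EConv Rr A B → ETyped Ar Rr Γ M B
  | pi {Γ s₁ s₂ s₃ A B} : Rr s₁ s₂ s₃ → ETyped Ar Rr Γ A (ETm.sort s₁) →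
      ETyped Ar Rr (A :: Γ) B (ETm.sort s₂) →
      ETyped Ar Rr Γ (ETm.pi s₁ s₂ A B) (ETm.sort s₃)
  | lam {Γ s₁ s₂ s₃ A B M} : Rr s₁ s₂ s₃ → ETyped Ar Rr Γ A (ETm.sort s₁) →
      ETyped Ar Rr (A :: Γ) B (ETm.sort s₂) → ETyped Ar Rr (A :: Γ) M B →
      ETyped Ar Rr Γ (ETm.lam s₁ s₂ A B M) (ETm.pi s₁ s₂ A B)
  | app {Γ s₁ s₂ s₃ A B M N} : Rr s₁ s₂ s₃ → ETyped Ar Rr Γ A (ETm.sort s₁) →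
      ETyped Ar Rr (A :: Γ) B (ETm.sort s₂) → ETyped Ar Rr Γ N A →
      ETyped Ar Rr Γ M (ETm.pi s₁ s₂ A B) →
      ETyped Ar Rr Γ (ETm.app s₁ s₂ A B M N) (ETm.substAt 0 N B)
end

/-- `𝒜` and `ℛ` are functional relations. -/
def FunctionalSpec (Ar : S → S → Prop) (Rr : S → S → S → Prop) : Prop :=
  (∀ s t t', Ar s t → Ar s t' → t = t') ∧
  (∀ s₁ s₂ t t', Rr s₁ s₂ t → Rr s₁ s₂ t' → t = t')

/-- `s` is a top-sort. -/
def IsTopSort (Ar : S → S → Prop) (s : S) : Prop := ¬ ∃ s', Ar s s'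

/-- `Γ ⊢ A type`: `A` is a sort, or `Γ ⊢ A : s` for some sort `s`. -/
def ETypeJ (Ar : S → S → Prop) (Rr : S → S → S → Prop) (Γ : List (ETm S)) (A : ETm S) : Prop :=
  (∃ s, A = ETm.sort s) ∨ ∃ s, ETyped Ar Rr Γ A (ETm.sort s)

/-! ## (Implicit) Pure Type Systems -/

/-- PTS terms. -/
inductive PTm (S : Type) : Type
  | var : Nat → PTm S
  | sort : S → PTm S
  | pi : PTm S → PTm S → PTm S
  | lam : PTm S → PTm S → PTm S
  | app : PTm S → PTm S → PTm S

namespace PTm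
variable {S : Type}

def ren (ρ : Nat → Nat) : PTm S → PTm S
  | var n => var (ρ n)
  | sort s => sort s
  | pi A B => pi (ren ρ A) (ren (Tm.liftRen ρ) B)
  | lam A M => lam (ren ρ A) (ren (Tm.liftRen ρ) M)
  | app M N => app (ren ρ M) (ren ρ N)

def liftSub (σ : Nat → PTm S) : Nat → PTm S
  | 0 => var 0
  | n + 1 => ren Nat.succ (σ n)

def sub (σ : Nat → PTm S) : PTm S → PTm S
  | var n => σ n
  | sort s => sort s
  | pi A B => pi (sub σ A) (sub (liftSub σ) B)
  | lam A M => lam (sub σ A) (sub (liftSub σ) M)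
  | app M N => app (sub σ M) (sub σ N)

def substAt (k : Nat) (N : PTm S) : PTm S → PTm S :=
  sub fun n => if n < k then var n else if n = k then ren (· + k) N else var (n - 1)

end PTm

/-- One-step β-reduction of PTS terms. -/
inductive PBeta : PTm S → PTm S → Prop
  | red {A M N} : PBeta (PTm.app (PTm.lam A M) N) (PTm.substAt 0 N M)
  | piA {A A' B} : PBeta A A' → PBeta (PTm.pi A B) (PTm.pi A' B)
  | piB {A B B'} : PBeta B B' → PBeta (PTm.pi A B) (PTm.pi A B')
  | lamA {A A' M} : PBeta A A' → PBeta (PTm.lam A M) (PTm.lam A' M)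
  | lamM {A M M'} : PBeta M M' → PBeta (PTm.lam A M) (PTm.lam A M')
  | appL {M M' N} : PBeta M M' → PBeta (PTm.app M N) (PTm.app M' N)
  | appR {M N N'} : PBeta N N' → PBeta (PTm.app M N) (PTm.app M N')

/-- PTS conversion. -/
def PConv : PTm S → PTm S → Prop := Relation.EqvGen PBeta

mutual
/-- Well-formed PTS contexts. -/
inductive PWf (Ar : S → S → Prop) (Rr : S → S → S → Prop) : List (PTm S) → Prop
  | empty : PWf Ar Rr []
  | decl {Γ A s} : PTyped Ar Rr Γ A (PTm.sort s) → PWf Ar Rr (A :: Γ)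

/-- The PTS typing judgment. -/
inductive PTyped (Ar : S → S → Prop) (Rr : S → S → S → Prop) : List (PTm S) → PTm S → PTm S → Prop
  | sort {Γ s₁ s₂} : PWf Ar Rr Γ → Ar s₁ s₂ → PTyped Ar Rr Γ (PTm.sort s₁) (PTm.sort s₂)
  | var {Γ n A} : PWf Ar Rr Γ → Γ[n]? = some A →
      PTyped Ar Rr Γ (PTm.var n) (PTm.ren (· + (n + 1)) A)
  | conv {Γ M A B s} : PTyped Ar Rr Γ M A → PTyped Ar Rr Γ B (PTm.sort s) →
      PConv A B → PTyped Ar Rr Γ M B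
  | pi {Γ s₁ s₂ s₃ A B} : Rr s₁ s₂ s₃ → PTyped Ar Rr Γ A (PTm.sort s₁) →
      PTyped Ar Rr (A :: Γ) B (PTm.sort s₂) →
      PTyped Ar Rr Γ (PTm.pi A B) (PTm.sort s₃)
  | lam {Γ s₁ s₂ s₃ A B M} : Rr s₁ s₂ s₃ → PTyped Ar Rr Γ A (PTm.sort s₁) →
      PTyped Ar Rr (A :: Γ) B (PTm.sort s₂) → PTyped Ar Rr (A :: Γ) M B →
      PTyped Ar Rr Γ (PTm.lam A M) (PTm.pi A B)
  | app {Γ A B M N} : PTyped Ar Rr Γ M (PTm.pi A B) → PTyped Ar Rr Γ N A →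
      PTyped Ar Rr Γ (PTm.app M N) (PTm.substAt 0 N B)
end

/-- `Γ ⊢_PTS A type`. -/
def PTypeJ (Ar : S → S → Prop) (Rr : S → S → S → Prop) (Γ : List (PTm S)) (A : PTm S) : Prop :=
  (∃ s, A = PTm.sort s) ∨ ∃ s, PTyped Ar Rr Γ A (PTm.sort s)

/-- The natural erasure from EPTS terms to PTS terms. -/
def epsErase : ETm S → PTm S
  | ETm.var n => PTm.var n
  | ETm.sort s => PTm.sort s
  | ETm.pi _ _ A B => PTm.pi (epsErase A) (epsErase B)
  | ETm.lam _ _ A _ M => PTm.lam (epsErase A) (epsErase M)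
  | ETm.app _ _ _ _ M N => PTm.app (epsErase M) (epsErase N)

/-! ## The encoding of EPTSs in Dedukti -/

/-- The constants of the theory `(Σ_EPTS, 𝓡_EPTS)`. -/
inductive EConst (S : Type) : Type
  | U : S → EConst S
  | El : S → EConst S
  | u : S → EConst S
  | Prod : S → S → EConst S
  | abs : S → S → EConst S
  | app : S → S → EConst S

/-- `U_s`. -/
def Ucon (s : S) : Tm (EConst S) := Tm.const (EConst.U s) []
/-- `El_s A`. -/
def Elcon (s : S) (A : Tm (EConst S)) : Tm (EConst S) := Tm.const (EConst.El s) [A]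
/-- `u_s`. -/
def ucon (s : S) : Tm (EConst S) := Tm.const (EConst.u s) []
/-- `Prod_{s₁,s₂} A B`. -/
def ProdC (s₁ s₂ : S) (A B : Tm (EConst S)) : Tm (EConst S) :=
  Tm.const (EConst.Prod s₁ s₂) [A, B]
/-- `abs_{s₁,s₂} A B M`. -/
def absC (s₁ s₂ : S) (A B M : Tm (EConst S)) : Tm (EConst S) :=
  Tm.const (EConst.abs s₁ s₂) [A, B, M]
/-- `app_{s₁,s₂} A B M N`. -/
def appC (s₁ s₂ : S) (A B M N : Tm (EConst S)) : Tm (EConst S) :=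
  Tm.const (EConst.app s₁ s₂) [A, B, M, N]

/-- The signature `Σ_EPTS` (telescopes in de Bruijn form). -/
inductive SigEPTSMem (Ar : S → S → Prop) (Rr : S → S → S → Prop) :
    EConst S × List (Tm (EConst S)) × Tm (EConst S) → Prop
  | U (s : S) : SigEPTSMem Ar Rr (EConst.U s, [], Tm.type)
  | El (s : S) : SigEPTSMem Ar Rr (EConst.El s, [Ucon s], Tm.type)
  | u {s₁ s₂} : Ar s₁ s₂ → SigEPTSMem Ar Rr (EConst.u s₁, [], Ucon s₂)
  | Prod {s₁ s₂ s₃} : Rr s₁ s₂ s₃ →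
      SigEPTSMem Ar Rr (EConst.Prod s₁ s₂,
        [Ucon s₁, Tm.pi (Elcon s₁ (Tm.var 0)) (Ucon s₂)],
        Ucon s₃)
  | abs {s₁ s₂ s₃} : Rr s₁ s₂ s₃ →
      SigEPTSMem Ar Rr (EConst.abs s₁ s₂,
        [Ucon s₁, Tm.pi (Elcon s₁ (Tm.var 0)) (Ucon s₂),
         Tm.pi (Elcon s₁ (Tm.var 1)) (Elcon s₂ (Tm.app (Tm.var 1) (Tm.var 0)))],
        Elcon s₃ (ProdC s₁ s₂ (Tm.var 2) (Tm.var 1)))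
  | app {s₁ s₂ s₃} : Rr s₁ s₂ s₃ →
      SigEPTSMem Ar Rr (EConst.app s₁ s₂,
        [Ucon s₁, Tm.pi (Elcon s₁ (Tm.var 0)) (Ucon s₂),
         Elcon s₃ (ProdC s₁ s₂ (Tm.var 1) (Tm.var 0)),
         Elcon s₁ (Tm.var 2)],
        Elcon s₂ (Tm.app (Tm.var 2) (Tm.var 0)))

/-- `Σ_EPTS` as a signature. -/
def sigEPTS (Ar : S → S → Prop) (Rr : S → S → S → Prop) : Sig (EConst S) :=
  fun e => SigEPTSMem Ar Rr e

/-- The rules `El_{s₂} u_{s₁} ↪ U_{s₁}` for `(s₁,s₂) ∈ 𝒜`. -/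
inductive URulesMem (Ar : S → S → Prop) :
    EConst S × List (Tm (EConst S)) × Tm (EConst S) → Prop
  | u_red {s₁ s₂} : Ar s₁ s₂ → URulesMem Ar (EConst.El s₂, [ucon s₁], Ucon s₁)

/-- The rules `app_{s₁,s₂} A B (abs_{s₁,s₂} A' B' M) N ↪ M N` for `(s₁,s₂,s₃) ∈ ℛ`
(pattern variables `A,B,A',B',M,N` are the de Bruijn variables `0,…,5`). -/
inductive BetaRulesMem (Rr : S → S → S → Prop) :
    EConst S × List (Tm (EConst S)) × Tm (EConst S) → Prop
  | beta {s₁ s₂ s₃} : Rr s₁ s₂ s₃ →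
      BetaRulesMem Rr (EConst.app s₁ s₂,
        [Tm.var 0, Tm.var 1, absC s₁ s₂ (Tm.var 2) (Tm.var 3) (Tm.var 4), Tm.var 5],
        Tm.app (Tm.var 4) (Tm.var 5))

/-- The `u_{s₁}`-red rules as a rule set. -/
def uRules (Ar : S → S → Prop) : Rules (EConst S) := fun e => URulesMem Ar e

/-- The `beta_{s₁,s₂}` rules as a rule set. -/
def betaRules (Rr : S → S → S → Prop) : Rules (EConst S) := fun e => BetaRulesMem Rr e

/-- The rewrite system `𝓡_EPTS`. -/
def rulesEPTS (Ar : S → S → Prop) (Rr : S → S → S → Prop) : Rules (EConst S) :=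
  uRules Ar ∪ betaRules Rr

/-- The translation `⟦·⟧` from EPTS terms to Dedukti terms. -/
def trans : ETm S → Tm (EConst S)
  | ETm.var n => Tm.var n
  | ETm.sort s => ucon s
  | ETm.pi s₁ s₂ A B =>
      ProdC s₁ s₂ (trans A) (Tm.lam (Elcon s₁ (trans A)) (trans B))
  | ETm.lam s₁ s₂ A B M =>
      absC s₁ s₂ (trans A) (Tm.lam (Elcon s₁ (trans A)) (trans B))
        (Tm.lam (Elcon s₁ (trans A)) (trans M))
  | ETm.app s₁ s₂ A B M N =>
      appC s₁ s₂ (trans A) (Tm.lam (Elcon s₁ (trans A)) (trans B)) (trans M) (trans N)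

/-- The translation `⟦·⟧` on (well-formed) contexts: `⟦Γ, x:A⟧ = ⟦Γ⟧, x : El_{s_A} ⟦A⟧`
where `Γ ⊢ A : s_A`. -/
inductive TransCtx (Ar : S → S → Prop) (Rr : S → S → S → Prop) :
    List (ETm S) → List (Tm (EConst S)) → Prop
  | nil : TransCtx Ar Rr [] []
  | cons {Γ Δ A sA} : TransCtx Ar Rr Γ Δ → ETyped Ar Rr Γ A (ETm.sort sA) →
      TransCtx Ar Rr (A :: Γ) (Elcon sA (trans A) :: Δ)

/-- Invertible forms. -/
inductive Invertible : Tm (EConst S) → Prop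
  | var {n} : Invertible (Tm.var n)
  | u {s} : Invertible (ucon s)
  | abs {s₁ s₂ A T₁ B T₂ M} : Invertible A → Invertible B → Invertible M →
      Invertible (absC s₁ s₂ A (Tm.lam T₁ B) (Tm.lam T₂ M))
  | beta {T M N} : Invertible M → Invertible N →
      Invertible (Tm.app (Tm.lam T M) N)
  | prod {s₁ s₂ A T₁ B} : Invertible A → Invertible B →
      Invertible (ProdC s₁ s₂ A (Tm.lam T₁ B))
  | app {s₁ s₂ A T₁ B M N} : Invertible A → Invertible B → Invertible M → Invertible N →
      Invertible (appC s₁ s₂ A (Tm.lam T₁ B) M N)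

/-- The inverse translation `|·|`, defined (at least) on invertible forms. -/
def inv : Tm (EConst S) → Option (ETm S)
  | Tm.var n => some (ETm.var n)
  | Tm.const (EConst.u s) [] => some (ETm.sort s)
  | Tm.app (Tm.lam _ M) N => do
      return ETm.substAt 0 (← inv N) (← inv M)
  | Tm.const (EConst.Prod s₁ s₂) [A, Tm.lam _ B] => do
      return ETm.pi s₁ s₂ (← inv A) (← inv B)
  | Tm.const (EConst.abs s₁ s₂) [A, Tm.lam _ B, Tm.lam _ M] => do
      return ETm.lam s₁ s₂ (← inv A) (← inv B) (← inv M)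
  | Tm.const (EConst.app s₁ s₂) [A, Tm.lam _ B, M, N] => do
      return ETm.app s₁ s₂ (← inv A) (← inv B) (← inv M) (← inv N)
  | _ => none
termination_by t => sizeOf t
decreasing_by
  all_goals simp_wf
  all_goals omega

/-- Hidden rewriting steps: a `↪_{β𝓡}` step inside the type annotation of a binder. -/
def HStep (R : Rules (EConst S)) : Tm (EConst S) → Tm (EConst S) → Prop :=
  Cong fun M N => ∃ A A' P, Step R A A' ∧ M = Tm.lam A P ∧ N = Tm.lam A' P

/-- The hidden conversion `≡_H`. -/
def HConv (R : Rules (EConst S)) : Tm (EConst S) → Tm (EConst S) → Prop :=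
  Relation.EqvGen (HStep R)


/-! ## Renaming and substitution in the λ-calculus -/

namespace LTm
variable {K : Type}

theorem liftRen'_id : liftRen' (fun n => n) = fun n => n := by
  funext n; cases n <;> rfl

theorem ren_id (t : LTm K) : ren (fun n => n) t = t := by
  induction t with
  | lam M ih => rw [ren, liftRen'_id, ih]
  | _ => simp_all [ren]

theorem ren_ren (t : LTm K) (ρ ρ' : Nat → Nat) :
    ren ρ' (ren ρ t) = ren (fun n => ρ' (ρ n)) t := by
  induction t generalizing ρ ρ' with
  | lam M ih =>
    simp only [ren, ih]
    congr 2; funext n; cases n <;> rfl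
  | _ => simp_all [ren]

theorem sub_var (t : LTm K) : sub var t = t := by
  induction t with
  | lam M ih =>
    have h : liftSub (var : Nat → LTm K) = var := by
      funext n; cases n <;> rfl
    rw [sub, h, ih]
  | _ => simp_all [sub]

theorem sub_ren (t : LTm K) (ρ : Nat → Nat) (σ : Nat → LTm K) :
    sub σ (ren ρ t) = sub (fun n => σ (ρ n)) t := by
  induction t generalizing ρ σ with
  | lam M ih =>
    simp only [ren, sub, ih]
    congr 2; funext n; cases n <;> rfl
  | _ => simp_all [ren, sub]

theorem ren_sub (t : LTm K) (ρ : Nat → Nat) (σ : Nat → LTm K) :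
    ren ρ (sub σ t) = sub (fun n => ren ρ (σ n)) t := by
  induction t generalizing ρ σ with
  | lam M ih =>
    simp only [ren, sub, ih]
    congr 2; funext n
    cases n with
    | zero => rfl
    | succ n => simp only [liftSub, ren_ren]; rfl
  | _ => simp_all [ren, sub]

theorem ren_substAt_zero (ρ : Nat → Nat) (M N : LTm K) :
    ren ρ (substAt 0 N M) = substAt 0 (ren ρ N) (ren (liftRen' ρ) M) := by
  simp only [substAt, ren_sub, sub_ren]
  congr 1; funext n
  cases n <;> simp [liftRen', ren, ren_id]

theorem ren_shiftAbove_one (ρ : Nat → Nat) (t : LTm K) :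
    ren (liftRen' (liftRen' ρ)) (shiftAbove 1 t) = shiftAbove 1 (ren (liftRen' ρ) t) := by
  simp only [shiftAbove, ren_ren]
  congr 1; funext n
  cases n <;> simp [liftRen']

theorem sub_shiftAbove_one (σ : Nat → LTm K) (t : LTm K) :
    sub (liftSub (liftSub σ)) (shiftAbove 1 t) = shiftAbove 1 (sub (liftSub σ) t) := by
  simp only [shiftAbove, sub_ren, ren_sub]
  congr 1; funext n
  cases n <;> simp [liftSub, ren, ren_ren]

theorem substAt_zero_lam_shiftAbove_one (M N : LTm K) :
    substAt 0 N (lam (shiftAbove 1 M)) = lam M := by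
  simp only [substAt, sub, shiftAbove, sub_ren]
  congr 1
  conv_rhs => rw [← sub_var M]
  congr 1; funext n
  cases n <;> simp [liftSub, ren]

theorem ren_foldl_app (ρ : Nat → Nat) (l : List (LTm K)) (t : LTm K) :
    ren ρ (l.foldl app t) = (l.map (ren ρ)).foldl app (ren ρ t) := by
  induction l generalizing t with
  | nil => rfl
  | cons a l ih => simp [ih, ren]

theorem sub_foldl_app (σ : Nat → LTm K) (l : List (LTm K)) (t : LTm K) :
    sub σ (l.foldl app t) = (l.map (sub σ)).foldl app (sub σ t) := by
  induction l generalizing t with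
  | nil => rfl
  | cons a l ih => simp [ih, sub]

end LTm

/-! ## Congruence of β-reduction in the λ-calculus -/

section LBetaCongruence
variable {K : Type}

theorem LBeta.ren {M N : LTm K} (h : LBeta M N) (ρ : Nat → Nat) :
    LBeta (LTm.ren ρ M) (LTm.ren ρ N) := by
  induction h generalizing ρ with
  | red => rw [LTm.ren_substAt_zero]; exact .red
  | appL _ ih => exact .appL (ih ρ)
  | appR _ ih => exact .appR (ih ρ)
  | lam _ ih => exact .lam (ih _)

theorem transGen_lBeta_ren {M N : LTm K} (ρ : Nat → Nat) (h : Relation.TransGen LBeta M N) :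
    Relation.TransGen LBeta (LTm.ren ρ M) (LTm.ren ρ N) :=
  h.lift _ fun _ _ h => h.ren ρ

theorem transGen_lBeta_appL {M M' : LTm K} (N : LTm K) (h : Relation.TransGen LBeta M M') :
    Relation.TransGen LBeta (.app M N) (.app M' N) :=
  h.lift (fun t => LTm.app t N) fun _ _ => LBeta.appL

theorem transGen_lBeta_appR (M : LTm K) {N N' : LTm K} (h : Relation.TransGen LBeta N N') :
    Relation.TransGen LBeta (.app M N) (.app M N') :=
  h.lift (LTm.app M) fun _ _ => LBeta.appR

theorem transGen_lBeta_lam {M M' : LTm K} (h : Relation.TransGen LBeta M M') :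
    Relation.TransGen LBeta (.lam M) (.lam M') :=
  h.lift _ fun _ _ => .lam

theorem transGen_lBeta_foldl_app {M M' : LTm K} (l : List (LTm K))
    (h : Relation.TransGen LBeta M M') :
    Relation.TransGen LBeta (l.foldl .app M) (l.foldl .app M') := by
  induction l generalizing M M' with
  | nil => exact h
  | cons a l ih => exact ih (transGen_lBeta_appL a h)

/-- The erasure of a β-redex reduces in two steps to the erasure of its contractum. -/
theorem transGen_lBeta_erased_redex (P A Q : LTm K) :
    Relation.TransGen LBeta (.app (.app (.lam (.lam (LTm.shiftAbove 1 P))) A) Q)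
      (LTm.substAt 0 Q P) := by
  have h : LBeta (.app (.lam (.lam (LTm.shiftAbove 1 P))) A) (.lam P) := by
    conv_rhs => rw [← LTm.substAt_zero_lam_shiftAbove_one P A]
    exact .red
  exact .tail (.single (.appL h)) .red

end LBetaCongruence

/-! ## Equations for renaming, substitution and erasure -/

theorem Tm.ren_const (ρ : Nat → Nat) (c : C) (Ms : List (Tm C)) :
    Tm.ren ρ (.const c Ms) = .const c (Ms.map (Tm.ren ρ)) := by
  rw [Tm.ren, List.attach_map_val (f := Tm.ren ρ)]

theorem Tm.sub_const (σ : Nat → Tm C) (c : C) (Ms : List (Tm C)) :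
    Tm.sub σ (.const c Ms) = .const c (Ms.map (Tm.sub σ)) := by
  rw [Tm.sub, List.attach_map_val (f := Tm.sub σ)]

theorem erase_var (S : Sig C) (n : Nat) : erase S (.var n) = some (.var n) := by
  rw [erase]

theorem erase_const {S : Sig C} {c : C} {Ms : List (Tm C)} {ms : List (LTm (C ⊕ STy))}
    (h : Ms.mapM (erase S) = some ms) :
    erase S (.const c Ms) = some (ms.foldl .app (.const (.inl c))) := by
  have h' : (Ms.attach.mapM fun x => erase S x.1) = some ms := by
    rw [← h]
    conv_rhs => rw [← List.attach_map_subtype_val Ms, List.mapM_map]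
    rfl
  rw [erase, h']; rfl

theorem erase_app {S : Sig C} {M N : Tm C} {m n : LTm (C ⊕ STy)}
    (hM : erase S M = some m) (hN : erase S N = some n) :
    erase S (.app M N) = some (.app m n) := by
  rw [erase, hM, hN]; rfl

theorem erase_lam {S : Sig C} {A M : Tm C} {a m : LTm (C ⊕ STy)}
    (hA : erase S A = some a) (hM : erase S M = some m) :
    erase S (.lam A M) = some (.app (.lam (.lam (LTm.shiftAbove 1 m))) a) := by
  rw [erase, hA, hM]; rfl

theorem erase_pi {S : Sig C} {A B : Tm C} {s : STy} {a b : LTm (C ⊕ STy)}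
    (hs : tyErase S A = some s) (hA : erase S A = some a) (hB : erase S B = some b) :
    erase S (.pi A B) = some (.app (.app (.const (.inr s)) a) (.lam b)) := by
  rw [erase, hs, hA, hB]; rfl

theorem exists_mapM_eq_some_map {α β : Type} {f : α → Option β} {g : α → α} {h : β → β}
    {l : List α} (H : ∀ x ∈ l, ∃ y, f x = some y ∧ f (g x) = some (h y)) :
    ∃ ys, l.mapM f = some ys ∧ (l.map g).mapM f = some (ys.map h) := by
  induction l with
  | nil => exact ⟨[], rfl, rfl⟩
  | cons a l ih =>
    obtain ⟨y, hy, hy'⟩ := H a List.mem_cons_self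
    obtain ⟨ys, hys, hys'⟩ := ih fun x hx => H x (List.mem_cons_of_mem _ hx)
    refine ⟨y :: ys, ?_, ?_⟩
    · simp [List.mapM_cons, hy, hys]
    · simp [List.mapM_cons, hy', hys']

theorem exists_tyErase {S : Sig C} : ∀ {M : Tm C}, IsTypeFam S M → ∃ s, tyErase S M = some s
  | _, .const hc _ => ⟨.star, by simp [tyErase, hc]⟩
  | _, .app hT _ => by
    obtain ⟨s, hs⟩ := exists_tyErase hT
    exact ⟨s, by rw [tyErase, hs]⟩
  | _, .lam _ hT => by
    obtain ⟨s, hs⟩ := exists_tyErase hT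
    exact ⟨s, by rw [tyErase, hs]⟩
  | _, .pi hA hB => by
    obtain ⟨s, hs⟩ := exists_tyErase hA
    obtain ⟨t, ht⟩ := exists_tyErase hB
    exact ⟨.arr s t, by rw [tyErase, hs, ht]; rfl⟩

theorem tyErase_ren {S : Sig C} (M : Tm C) (ρ : Nat → Nat) :
    tyErase S (Tm.ren ρ M) = tyErase S M := by
  match M with
  | .var _ | .const _ _ | .type | .kind => simp [Tm.ren, tyErase]
  | .app A _ => rw [Tm.ren, tyErase, tyErase, tyErase_ren A]
  | .lam _ B => rw [Tm.ren, tyErase, tyErase, tyErase_ren B]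
  | .pi A B => rw [Tm.ren, tyErase, tyErase, tyErase_ren A, tyErase_ren B]

theorem tyErase_sub {S : Sig C} :
    ∀ {M : Tm C}, IsTypeFam S M → ∀ σ, tyErase S (Tm.sub σ M) = tyErase S M
  | _, .const _ _, σ => by simp [Tm.sub, tyErase]
  | _, .app hT _, σ => by rw [Tm.sub, tyErase, tyErase, tyErase_sub hT]
  | _, .lam _ hT, σ => by rw [Tm.sub, tyErase, tyErase, tyErase_sub hT]
  | _, .pi hA hB, σ => by rw [Tm.sub, tyErase, tyErase, tyErase_sub hA, tyErase_sub hB]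

/-! ## Erasure commutes with renaming and substitution -/

theorem Tm.liftRen_eq (ρ : Nat → Nat) : Tm.liftRen ρ = LTm.liftRen' ρ := by
  funext n; cases n <;> rfl

mutual
theorem IsObj.erase_ren {S : Sig C} {M : Tm C} (hM : IsObj S M) (ρ : Nat → Nat) :
    IsObj S (Tm.ren ρ M) ∧
      ∃ m, erase S M = some m ∧ erase S (Tm.ren ρ M) = some (LTm.ren ρ m) := by
  match hM with
  | .var => rw [Tm.ren]; exact ⟨.var, _, erase_var S _, erase_var S _⟩
  | .const hc hO =>
    have ih := fun O hO' => IsObj.erase_ren (hO O hO') ρ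
    obtain ⟨ms, h, h'⟩ := exists_mapM_eq_some_map fun O hO' => (ih O hO').2
    rw [Tm.ren_const]
    refine ⟨.const hc ?_, _, erase_const h, ?_⟩
    · simpa using fun O hO' => (ih O hO').1
    · rw [erase_const h', LTm.ren_foldl_app]; rfl
  | .app h₁ h₂ =>
    obtain ⟨c₁, m₁, e₁, e₁'⟩ := IsObj.erase_ren h₁ ρ
    obtain ⟨c₂, m₂, e₂, e₂'⟩ := IsObj.erase_ren h₂ ρ
    rw [Tm.ren]
    exact ⟨.app c₁ c₂, _, erase_app e₁ e₂, erase_app e₁' e₂'⟩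
  | .lam h₁ h₂ =>
    obtain ⟨c₁, m₁, e₁, e₁'⟩ := IsTypeFam.erase_ren h₁ ρ
    obtain ⟨c₂, m₂, e₂, e₂'⟩ := IsObj.erase_ren h₂ (Tm.liftRen ρ)
    rw [Tm.ren]
    refine ⟨.lam c₁ c₂, _, erase_lam e₁ e₂, ?_⟩
    rw [erase_lam e₁' e₂', Tm.liftRen_eq, ← LTm.ren_shiftAbove_one]; rfl

theorem IsTypeFam.erase_ren {S : Sig C} {M : Tm C} (hM : IsTypeFam S M) (ρ : Nat → Nat) :
    IsTypeFam S (Tm.ren ρ M) ∧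
      ∃ m, erase S M = some m ∧ erase S (Tm.ren ρ M) = some (LTm.ren ρ m) := by
  match hM with
  | .const hc hO =>
    have ih := fun O hO' => IsObj.erase_ren (hO O hO') ρ
    obtain ⟨ms, h, h'⟩ := exists_mapM_eq_some_map fun O hO' => (ih O hO').2
    rw [Tm.ren_const]
    refine ⟨.const hc ?_, _, erase_const h, ?_⟩
    · simpa using fun O hO' => (ih O hO').1
    · rw [erase_const h', LTm.ren_foldl_app]; rfl
  | .app h₁ h₂ =>
    obtain ⟨c₁, m₁, e₁, e₁'⟩ := IsTypeFam.erase_ren h₁ ρ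
    obtain ⟨c₂, m₂, e₂, e₂'⟩ := IsObj.erase_ren h₂ ρ
    rw [Tm.ren]
    exact ⟨.app c₁ c₂, _, erase_app e₁ e₂, erase_app e₁' e₂'⟩
  | .lam h₁ h₂ =>
    obtain ⟨c₁, m₁, e₁, e₁'⟩ := IsTypeFam.erase_ren h₁ ρ
    obtain ⟨c₂, m₂, e₂, e₂'⟩ := IsTypeFam.erase_ren h₂ (Tm.liftRen ρ)
    rw [Tm.ren]
    refine ⟨.lam c₁ c₂, _, erase_lam e₁ e₂, ?_⟩
    rw [erase_lam e₁' e₂', Tm.liftRen_eq, ← LTm.ren_shiftAbove_one]; rfl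
  | .pi h₁ h₂ =>
    obtain ⟨c₁, m₁, e₁, e₁'⟩ := IsTypeFam.erase_ren h₁ ρ
    obtain ⟨c₂, m₂, e₂, e₂'⟩ := IsTypeFam.erase_ren h₂ (Tm.liftRen ρ)
    obtain ⟨s, hs⟩ := exists_tyErase h₁
    rw [Tm.ren]
    refine ⟨.pi c₁ c₂, _, erase_pi hs e₁ e₂, ?_⟩
    rw [erase_pi ((tyErase_ren _ ρ).trans hs) e₁' e₂', Tm.liftRen_eq]; rfl
end

theorem IsObj.exists_erase {S : Sig C} {M : Tm C} (hM : IsObj S M) :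
    ∃ m, erase S M = some m :=
  (hM.erase_ren id).2.imp fun _ h => h.1

theorem IsTypeFam.exists_erase {S : Sig C} {M : Tm C} (hM : IsTypeFam S M) :
    ∃ m, erase S M = some m :=
  (hM.erase_ren id).2.imp fun _ h => h.1

/-- `σ` maps every variable to an object, whose erasure is given by `τ`. -/
def ErasesTo (S : Sig C) (σ : Nat → Tm C) (τ : Nat → LTm (C ⊕ STy)) : Prop :=
  ∀ n, IsObj S (σ n) ∧ erase S (σ n) = some (τ n)

theorem IsObj.erase_ren_eq {S : Sig C} {N : Tm C} {n : LTm (C ⊕ STy)} (hN : IsObj S N)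
    (hn : erase S N = some n) (ρ : Nat → Nat) :
    erase S (Tm.ren ρ N) = some (LTm.ren ρ n) := by
  obtain ⟨-, m, e, e'⟩ := hN.erase_ren ρ
  rw [e', Option.some.inj (e.symm.trans hn)]

theorem ErasesTo.lift {S : Sig C} {σ : Nat → Tm C} {τ : Nat → LTm (C ⊕ STy)}
    (h : ErasesTo S σ τ) : ErasesTo S (Tm.liftSub σ) (LTm.liftSub τ) := by
  intro n
  cases n with
  | zero => exact ⟨.var, erase_var S 0⟩
  | succ n => exact ⟨((h n).1.erase_ren _).1, (h n).1.erase_ren_eq (h n).2 _⟩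

theorem erasesTo_substAt {S : Sig C} {N : Tm C} {n : LTm (C ⊕ STy)} (hN : IsObj S N)
    (hn : erase S N = some n) (k : Nat) :
    ErasesTo S
      (fun i => if i < k then .var i else if i = k then Tm.ren (· + k) N else .var (i - 1))
      (fun i => if i < k then .var i else if i = k then LTm.ren (· + k) n else .var (i - 1)) := by
  intro i
  dsimp only
  split_ifs
  · exact ⟨.var, erase_var S _⟩
  · exact ⟨(hN.erase_ren _).1, hN.erase_ren_eq hn _⟩
  · exact ⟨.var, erase_var S _⟩

mutual
theorem IsObj.erase_sub {S : Sig C} {M : Tm C} (hM : IsObj S M) {σ : Nat → Tm C}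
    {τ : Nat → LTm (C ⊕ STy)} (hσ : ErasesTo S σ τ) :
    IsObj S (Tm.sub σ M) ∧
      ∃ m, erase S M = some m ∧ erase S (Tm.sub σ M) = some (LTm.sub τ m) := by
  match hM with
  | .var => rw [Tm.sub]; exact ⟨(hσ _).1, _, erase_var S _, (hσ _).2⟩
  | .const hc hO =>
    have ih := fun O hO' => IsObj.erase_sub (hO O hO') hσ
    obtain ⟨ms, h, h'⟩ := exists_mapM_eq_some_map fun O hO' => (ih O hO').2
    rw [Tm.sub_const]
    refine ⟨.const hc ?_, _, erase_const h, ?_⟩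
    · simpa using fun O hO' => (ih O hO').1
    · rw [erase_const h', LTm.sub_foldl_app]; rfl
  | .app h₁ h₂ =>
    obtain ⟨c₁, m₁, e₁, e₁'⟩ := IsObj.erase_sub h₁ hσ
    obtain ⟨c₂, m₂, e₂, e₂'⟩ := IsObj.erase_sub h₂ hσ
    rw [Tm.sub]
    exact ⟨.app c₁ c₂, _, erase_app e₁ e₂, erase_app e₁' e₂'⟩
  | .lam h₁ h₂ =>
    obtain ⟨c₁, m₁, e₁, e₁'⟩ := IsTypeFam.erase_sub h₁ hσ
    obtain ⟨c₂, m₂, e₂, e₂'⟩ := IsObj.erase_sub h₂ hσ.lift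
    rw [Tm.sub]
    refine ⟨.lam c₁ c₂, _, erase_lam e₁ e₂, ?_⟩
    rw [erase_lam e₁' e₂', ← LTm.sub_shiftAbove_one]; rfl

theorem IsTypeFam.erase_sub {S : Sig C} {M : Tm C} (hM : IsTypeFam S M) {σ : Nat → Tm C}
    {τ : Nat → LTm (C ⊕ STy)} (hσ : ErasesTo S σ τ) :
    IsTypeFam S (Tm.sub σ M) ∧
      ∃ m, erase S M = some m ∧ erase S (Tm.sub σ M) = some (LTm.sub τ m) := by
  match hM with
  | .const hc hO =>
    have ih := fun O hO' => IsObj.erase_sub (hO O hO') hσ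
    obtain ⟨ms, h, h'⟩ := exists_mapM_eq_some_map fun O hO' => (ih O hO').2
    rw [Tm.sub_const]
    refine ⟨.const hc ?_, _, erase_const h, ?_⟩
    · simpa using fun O hO' => (ih O hO').1
    · rw [erase_const h', LTm.sub_foldl_app]; rfl
  | .app h₁ h₂ =>
    obtain ⟨c₁, m₁, e₁, e₁'⟩ := IsTypeFam.erase_sub h₁ hσ
    obtain ⟨c₂, m₂, e₂, e₂'⟩ := IsObj.erase_sub h₂ hσ
    rw [Tm.sub]
    exact ⟨.app c₁ c₂, _, erase_app e₁ e₂, erase_app e₁' e₂'⟩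
  | .lam h₁ h₂ =>
    obtain ⟨c₁, m₁, e₁, e₁'⟩ := IsTypeFam.erase_sub h₁ hσ
    obtain ⟨c₂, m₂, e₂, e₂'⟩ := IsTypeFam.erase_sub h₂ hσ.lift
    rw [Tm.sub]
    refine ⟨.lam c₁ c₂, _, erase_lam e₁ e₂, ?_⟩
    rw [erase_lam e₁' e₂', ← LTm.sub_shiftAbove_one]; rfl
  | .pi h₁ h₂ =>
    obtain ⟨c₁, m₁, e₁, e₁'⟩ := IsTypeFam.erase_sub h₁ hσ
    obtain ⟨c₂, m₂, e₂, e₂'⟩ := IsTypeFam.erase_sub h₂ hσ.lift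
    obtain ⟨s, hs⟩ := exists_tyErase h₁
    rw [Tm.sub]
    refine ⟨.pi c₁ c₂, _, erase_pi hs e₁ e₂, ?_⟩
    rw [erase_pi ((tyErase_sub h₁ σ).trans hs) e₁' e₂']; rfl
end

/-! ## Erasure simulates β-reduction -/

/-- The erasures of `M` and `N` are defined, and that of `M` reduces to that of `N`
in at least one β-step. -/
def ErasedReduces (S : Sig C) (M N : Tm C) : Prop :=
  ∃ m n, erase S M = some m ∧ erase S N = some n ∧ Relation.TransGen LBeta m n

namespace ErasedReduces
variable {S : Sig C} {A A' M M' N N' : Tm C}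

theorem appL (h : ErasedReduces S M M') (hN : IsObj S N) :
    ErasedReduces S (.app M N) (.app M' N) := by
  obtain ⟨m, m', e, e', r⟩ := h
  obtain ⟨n, en⟩ := hN.exists_erase
  exact ⟨_, _, erase_app e en, erase_app e' en, transGen_lBeta_appL _ r⟩

theorem appR (hM : ∃ m, erase S M = some m) (h : ErasedReduces S N N') :
    ErasedReduces S (.app M N) (.app M N') := by
  obtain ⟨n, n', e, e', r⟩ := h
  obtain ⟨m, em⟩ := hM
  exact ⟨_, _, erase_app em e, erase_app em e', transGen_lBeta_appR _ r⟩

theorem lamA (h : ErasedReduces S A A') (hM : ∃ m, erase S M = some m) :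
    ErasedReduces S (.lam A M) (.lam A' M) := by
  obtain ⟨a, a', e, e', r⟩ := h
  obtain ⟨m, em⟩ := hM
  exact ⟨_, _, erase_lam e em, erase_lam e' em, transGen_lBeta_appR _ r⟩

theorem lamM (hA : IsTypeFam S A) (h : ErasedReduces S M M') :
    ErasedReduces S (.lam A M) (.lam A M') := by
  obtain ⟨m, m', e, e', r⟩ := h
  obtain ⟨a, ea⟩ := hA.exists_erase
  exact ⟨_, _, erase_lam ea e, erase_lam ea e', transGen_lBeta_appL _
    (transGen_lBeta_lam (transGen_lBeta_lam (transGen_lBeta_ren _ r)))⟩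

theorem piA (hA : IsTypeFam S A) (hty : tyErase S A' = tyErase S A)
    (h : ErasedReduces S A A') (hM : IsTypeFam S M) :
    ErasedReduces S (.pi A M) (.pi A' M) := by
  obtain ⟨a, a', e, e', r⟩ := h
  obtain ⟨m, em⟩ := hM.exists_erase
  obtain ⟨s, hs⟩ := exists_tyErase hA
  exact ⟨_, _, erase_pi hs e em, erase_pi (hty.trans hs) e' em,
    transGen_lBeta_appL _ (transGen_lBeta_appR _ r)⟩

theorem piB (hA : IsTypeFam S A) (h : ErasedReduces S M M') :
    ErasedReduces S (.pi A M) (.pi A M') := by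
  obtain ⟨m, m', e, e', r⟩ := h
  obtain ⟨a, ea⟩ := hA.exists_erase
  obtain ⟨s, hs⟩ := exists_tyErase hA
  exact ⟨_, _, erase_pi hs ea e, erase_pi hs ea e',
    transGen_lBeta_appR _ (transGen_lBeta_lam r)⟩

theorem constArg (c : C) {l₁ l₂ : List (Tm C)} (h₁ : ∀ O ∈ l₁, IsObj S O)
    (h₂ : ∀ O ∈ l₂, IsObj S O) (h : ErasedReduces S M M') :
    ErasedReduces S (.const c (l₁ ++ M :: l₂)) (.const c (l₁ ++ M' :: l₂)) := by
  have defined : ∀ l : List (Tm C), (∀ O ∈ l, IsObj S O) → ∃ ms, l.mapM (erase S) = some ms := by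
    intro l hl
    obtain ⟨ms, h, -⟩ := exists_mapM_eq_some_map (f := erase S) (g := id) (h := id) (l := l)
      fun O hO => (hl O hO).exists_erase.imp fun _ e => ⟨e, e⟩
    exact ⟨ms, h⟩
  obtain ⟨m, m', e, e', r⟩ := h
  obtain ⟨ms₁, e₁⟩ := defined l₁ h₁
  obtain ⟨ms₂, e₂⟩ := defined l₂ h₂
  refine ⟨_, _, erase_const (ms := ms₁ ++ m :: ms₂) ?_,
    erase_const (ms := ms₁ ++ m' :: ms₂) ?_, ?_⟩
  · simp [List.mapM_append, List.mapM_cons, e₁, e₂, e]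
  · simp [List.mapM_append, List.mapM_cons, e₁, e₂, e']
  · simp only [List.foldl_append, List.foldl_cons]
    exact transGen_lBeta_foldl_app _ (transGen_lBeta_appR _ r)

end ErasedReduces

theorem forall_isObj_replace {S : Sig C} {l₁ l₂ : List (Tm C)} {M M' : Tm C}
    (h : ∀ O ∈ l₁ ++ M :: l₂, IsObj S O) (hM' : IsObj S M') :
    ∀ O ∈ l₁ ++ M' :: l₂, IsObj S O := by
  simp only [List.mem_append, List.mem_cons] at h ⊢
  rintro O (hO | rfl | hO)
  · exact h O (.inl hO)
  · exact hM'
  · exact h O (.inr (.inr hO))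

/-- β-reduction preserves objects, type families and the erasure of type families to simple
types, and is simulated by the term erasure. -/
theorem Beta.erase {S : Sig C} {M N : Tm C} (h : Beta M N) :
    (IsObj S M → IsObj S N ∧ ErasedReduces S M N) ∧
      (IsTypeFam S M → IsTypeFam S N ∧ tyErase S N = tyErase S M ∧ ErasedReduces S M N) := by
  induction h with
  | base h =>
    obtain ⟨A, P, Q, rfl, rfl⟩ := h
    constructor
    · rintro (_ | _ | ⟨_ | _ | _ | ⟨hA, hP⟩, hQ⟩)
      obtain ⟨a, ea⟩ := hA.exists_erase
      obtain ⟨q, eq⟩ := hQ.exists_erase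
      obtain ⟨c, p, ep, er⟩ := hP.erase_sub (erasesTo_substAt hQ eq 0)
      exact ⟨c, _, _, erase_app (erase_lam ea ep) eq, er, transGen_lBeta_erased_redex _ _ _⟩
    · rintro (_ | ⟨_ | _ | ⟨hA, hP⟩, hQ⟩)
      obtain ⟨a, ea⟩ := hA.exists_erase
      obtain ⟨q, eq⟩ := hQ.exists_erase
      obtain ⟨c, p, ep, er⟩ := hP.erase_sub (erasesTo_substAt hQ eq 0)
      exact ⟨c, tyErase_sub hP _, _, _, erase_app (erase_lam ea ep) eq, er,
        transGen_lBeta_erased_redex _ _ _⟩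
  | appL _ ih =>
    constructor
    · rintro (_ | _ | ⟨hM, hN⟩)
      obtain ⟨c, r⟩ := ih.1 hM
      exact ⟨.app c hN, r.appL hN⟩
    · rintro (_ | ⟨hM, hN⟩)
      obtain ⟨c, t, r⟩ := ih.2 hM
      exact ⟨.app c hN, by rw [tyErase, tyErase, t], r.appL hN⟩
  | appR _ ih =>
    constructor
    · rintro (_ | _ | ⟨hM, hN⟩)
      obtain ⟨c, r⟩ := ih.1 hN
      exact ⟨.app hM c, .appR hM.exists_erase r⟩
    · rintro (_ | ⟨hM, hN⟩)
      obtain ⟨c, r⟩ := ih.1 hN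
      exact ⟨.app hM c, rfl, .appR hM.exists_erase r⟩
  | lamA _ ih =>
    constructor
    · rintro (_ | _ | _ | ⟨hA, hM⟩)
      obtain ⟨c, -, r⟩ := ih.2 hA
      exact ⟨.lam c hM, r.lamA hM.exists_erase⟩
    · rintro (_ | _ | ⟨hA, hM⟩)
      obtain ⟨c, -, r⟩ := ih.2 hA
      exact ⟨.lam c hM, rfl, r.lamA hM.exists_erase⟩
  | lamM _ ih =>
    constructor
    · rintro (_ | _ | _ | ⟨hA, hM⟩)
      obtain ⟨c, r⟩ := ih.1 hM
      exact ⟨.lam hA c, .lamM hA r⟩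
    · rintro (_ | _ | ⟨hA, hM⟩)
      obtain ⟨c, t, r⟩ := ih.2 hM
      exact ⟨.lam hA c, by rw [tyErase, tyErase, t], .lamM hA r⟩
  | piA _ ih =>
    refine ⟨nofun, ?_⟩
    rintro (_ | _ | _ | ⟨hA, hB⟩)
    obtain ⟨c, t, r⟩ := ih.2 hA
    exact ⟨.pi c hB, by rw [tyErase, tyErase, t], .piA hA t r hB⟩
  | piB _ ih =>
    refine ⟨nofun, ?_⟩
    rintro (_ | _ | _ | ⟨hA, hB⟩)
    obtain ⟨c, t, r⟩ := ih.2 hB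
    exact ⟨.pi hA c, by rw [tyErase, tyErase, t], .piB hA r⟩
  | @constArg k l₁ M M' l₂ _ ih =>
    have key (hO : ∀ O ∈ l₁ ++ M :: l₂, IsObj S O) : IsObj S M' ∧
        ErasedReduces S (.const k (l₁ ++ M :: l₂)) (.const k (l₁ ++ M' :: l₂)) := by
      obtain ⟨c, r⟩ := ih.1 (hO M (by simp))
      exact ⟨c, .constArg k (fun O h => hO O (by simp [h])) (fun O h => hO O (by simp [h])) r⟩
    constructor
    · rintro (_ | ⟨hc, hO⟩)
      exact ⟨.const hc (forall_isObj_replace hO (key hO).1), (key hO).2⟩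
    · rintro (⟨hc, hO⟩)
      exact ⟨.const hc (forall_isObj_replace hO (key hO).1), by rw [tyErase, tyErase], (key hO).2⟩

/-- Preservation of substitution and of non-termination by the term
erasure. -/
theorem erase_preserves_subst_and_beta {C : Type} (S : Sig C) (R : Rules C)
    (hSfin : S.Finite)
    (hconf : Confluent (Step R)) (hap : ArityPreserving S R)
    {M : Tm C} (hM : IsObj S M ∨ IsTypeFam S M) :
    (∀ (N : Tm C) (k : Nat), IsObj S N →
      (IsObj S (Tm.substAt k N M) ∨ IsTypeFam S (Tm.substAt k N M)) ∧
      ∃ m n, erase S M = some m ∧ erase S N = some n ∧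
        erase S (Tm.substAt k N M) = some (LTm.substAt k n m)) ∧
    (∀ N' : Tm C, Beta M N' →
      (IsObj S N' ∨ IsTypeFam S N') ∧
      ∃ m n', erase S M = some m ∧ erase S N' = some n' ∧
        Relation.TransGen LBeta m n') := by
  refine ⟨fun N k hN => ?_, fun N' h => ?_⟩
  · obtain ⟨n, hn⟩ := hN.exists_erase
    have hσ := erasesTo_substAt hN hn k
    rcases hM with hM | hM
    · obtain ⟨c, m, hm, hm'⟩ := hM.erase_sub hσ
      exact ⟨.inl c, m, n, hm, hn, hm'⟩
    · obtain ⟨c, m, hm, hm'⟩ := hM.erase_sub hσ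
      exact ⟨.inr c, m, n, hm, hn, hm'⟩
  · rcases hM with hM | hM
    · obtain ⟨c, r⟩ := h.erase.1 hM
      exact ⟨.inl c, r⟩
    · obtain ⟨c, -, r⟩ := h.erase.2 hM
      exact ⟨.inr c, r⟩

end DKPaper
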